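/- arXiv:2112.12897 — 3 statements merged into one kernel-verified Lean document; each statement's English description precedes it below -/
import Mathlib

section
/- Let τ_max > 0, let f : [0, τ_max] → ℝ be continuous, and let ε > 0. Then there exist polynomial functions g_u and g_n with g_u convex on [0, τ_max] and g_n concave on [0, τ_max] such that for all t ∈ [0, τ_max], f(t) ≤ g_u(t) + g_n(t) ≤ f(t) + 2ε; consequently max{0, f(t)} ≤ max{0, g_u(t) + g_n(t)} for all t ∈ [0, τ_max]. -/
theorem poly_decomp_aux (T : ℝ) (p : Polynomial ℝ) :
    ∃ gu gn : Polynomial ℝ,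
      ConvexOn ℝ (Set.Icc 0 T) (fun t => gu.eval t) ∧
      ConcaveOn ℝ (Set.Icc 0 T) (fun t => gn.eval t) ∧ p = gu + gn := by
  induction p using Polynomial.induction_on' with
  | add p q hp hq =>
    obtain ⟨a, b, ha, hb, rfl⟩ := hp
    obtain ⟨c, d, hc, hd, rfl⟩ := hq
    refine ⟨a + c, b + d, ?_, ?_, by ring⟩
    · simpa only [Polynomial.eval_add] using! ha.add hc
    · simpa only [Polynomial.eval_add] using! hb.add hd
  | monomial n a =>
    have hpow : ConvexOn ℝ (Set.Icc 0 T) (fun t : ℝ => t ^ n) :=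
      (convexOn_pow n).subset (fun t ht => ht.1) (convex_Icc 0 T)
    rcases le_total 0 a with h | h
    · refine ⟨Polynomial.monomial n a, 0, ?_, ?_, by simp⟩
      · simpa only [Polynomial.eval_monomial] using! hpow.smul h
      · simpa only [Polynomial.eval_zero] using! concaveOn_const (0 : ℝ) (convex_Icc 0 T)
    · refine ⟨0, Polynomial.monomial n a, ?_, ?_, by simp⟩
      · simpa only [Polynomial.eval_zero] using! convexOn_const (0 : ℝ) (convex_Icc 0 T)
      · have h2 := (hpow.smul (neg_nonneg.mpr h)).neg
        have h3 : (fun t : ℝ => (Polynomial.monomial n a).eval t) = -fun x : ℝ => -a • x ^ n := by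
          ext t
          simp
        rw [h3]
        exact h2

/-- Proposition 1 of the paper (via Stone–Weierstrass): a continuous rate
function on a finite interval can be upper-bounded, within `2ε`, by a
polynomial admitting a concave-convex decomposition; hence the rate
`max{0, f}` admits thinning by `max{0, g_u + g_n}`. -/
theorem continuous_rate_admits_concave_convex_thinning
    (τmax : ℝ) (hτ : 0 < τmax) (f : ℝ → ℝ)
    (hf : ContinuousOn f (Set.Icc 0 τmax)) (ε : ℝ) (hε : 0 < ε) :
    ∃ gu gn : Polynomial ℝ,
      ConvexOn ℝ (Set.Icc 0 τmax) (fun t => gu.eval t) ∧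
      ConcaveOn ℝ (Set.Icc 0 τmax) (fun t => gn.eval t) ∧
      (∀ t ∈ Set.Icc 0 τmax,
        f t ≤ gu.eval t + gn.eval t ∧ gu.eval t + gn.eval t ≤ f t + 2 * ε) ∧
      (∀ t ∈ Set.Icc 0 τmax,
        max 0 (f t) ≤ max 0 (gu.eval t + gn.eval t)) := by
  obtain ⟨p, hp⟩ := exists_polynomial_near_of_continuousOn 0 τmax f hf ε hε
  obtain ⟨gu, gn, hu, hn, he⟩ := poly_decomp_aux τmax (p + Polynomial.C ε)
  have key : ∀ t ∈ Set.Icc 0 τmax,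
      f t ≤ gu.eval t + gn.eval t ∧ gu.eval t + gn.eval t ≤ f t + 2 * ε := by
    intro t ht
    have h1 := abs_lt.mp (hp t ht)
    have h2 : gu.eval t + gn.eval t = p.eval t + ε := by
      rw [← Polynomial.eval_add, ← he]
      simp
    rw [h2]
    constructor <;> linarith [h1.1, h1.2]
  exact ⟨gu, gn, hu, hn, key, fun t ht => max_le_max le_rfl (key t ht).1⟩
end

section
/- Let b > 0 and y ∈ ℝ, and let ψ(a) = log(1 + (a − y)²/b) for a ∈ ℝ. Then the second derivative satisfies |ψ''(a)| ≤ 2/b for all a ∈ ℝ. -/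
/-- The second derivative of the Cauchy potential `ψ(a) = log(1 + (a-y)²/b)`
with scale `b > 0` is bounded in absolute value by `2/b`. -/
theorem cauchy_second_deriv_bound (b y : ℝ) (hb : 0 < b) :
    ∀ a : ℝ,
      |iteratedDeriv 2 (fun a : ℝ => Real.log (1 + (a - y) ^ 2 / b)) a| ≤
        2 / b := by
  intro a
  have hd : ∀ x : ℝ, HasDerivAt (fun a : ℝ => (a - y) ^ 2) (2 * (x - y)) x := by
    intro x
    have h := ((hasDerivAt_id x).sub_const y).pow 2
    refine HasDerivAt.congr_deriv h ?_
    simp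
  have h1 : deriv (fun a : ℝ => Real.log (1 + (a - y) ^ 2 / b))
      = fun x => 2 * (x - y) / (b + (x - y) ^ 2) := by
    funext x
    have hp : 0 < 1 + (x - y) ^ 2 / b := by positivity
    have hq : 0 < b + (x - y) ^ 2 := by positivity
    have h := (((hd x).div_const b).const_add 1).log hp.ne'
    rw [h.deriv]
    field_simp
  have hq : 0 < b + (a - y) ^ 2 := by positivity
  have h2 : HasDerivAt (fun x : ℝ => 2 * (x - y) / (b + (x - y) ^ 2))
      (2 * (b - (a - y) ^ 2) / (b + (a - y) ^ 2) ^ 2) a := by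
    have h := (((hasDerivAt_id a).sub_const y).const_mul 2).div ((hd a).const_add b) hq.ne'
    refine HasDerivAt.congr_deriv h ?_
    simp only [id, mul_one]
    ring
  rw [iteratedDeriv_succ, iteratedDeriv_one, h1, h2.deriv, abs_div,
    abs_of_pos (pow_pos hq 2), div_le_div_iff₀ (pow_pos hq 2) hb, abs_mul, abs_two]
  have h3 : |b - (a - y) ^ 2| ≤ b + (a - y) ^ 2 := by
    rw [abs_le]
    constructor <;> nlinarith [sq_nonneg (a - y)]
  nlinarith [sq_nonneg (a - y), mul_le_mul_of_nonneg_right h3 hb.le,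
    mul_nonneg hq.le (sq_nonneg (a - y))]
end

section
/- Let b ≥ 1 and y ∈ ℝ, and let ψ(a) = log(1 + (a − y)²/b) for a ∈ ℝ. Then the third derivative satisfies |ψ'''(a)| ≤ 3 for all a ∈ ℝ. -/
lemma cauchy_aux_poly (x : ℝ) : 0 ≤ 3 * (1 + x ^ 2) ^ 3 - 12 * x + 4 * x ^ 3 := by
  nlinarith [sq_nonneg (x ^ 3 + x / 3 - 1 / 5), sq_nonneg (x ^ 2 + x / 4 - 1 / 4),
    sq_nonneg (x ^ 2 + x - 3 / 5), sq_nonneg (x - 2 / 5), sq_nonneg (x ^ 2 - 1 / 6),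
    sq_nonneg (x * (x ^ 2 - 1 / 6)), sq_nonneg (x ^ 3)]

lemma cauchy_aux_poly2 (b x : ℝ) (hb : 1 ≤ b) :
    12 * b * x - 4 * x ^ 3 ≤ 3 * (b + x ^ 2) ^ 3 := by
  obtain ⟨c, rfl⟩ : ∃ c, b = 1 + c := ⟨b - 1, by ring⟩
  have hc : 0 ≤ c := by linarith
  have h1 := cauchy_aux_poly x
  have h2 : 0 ≤ 9 * (1 + x ^ 2) ^ 2 - 12 * x := by
    nlinarith [sq_nonneg (x - 1 / 3), sq_nonneg (x ^ 2)]
  have h3 := mul_nonneg hc h2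
  have h4 : 0 ≤ 9 * c ^ 2 * (1 + x ^ 2) + 3 * c ^ 3 := by positivity
  nlinarith

/-- The third derivative of the Cauchy potential `ψ(a) = log(1 + (a-y)²/b)`
with scale `b ≥ 1` is bounded in absolute value by `3`. -/
theorem cauchy_third_deriv_bound (b y : ℝ) (hb : 1 ≤ b) :
    ∀ a : ℝ,
      |iteratedDeriv 3 (fun a : ℝ => Real.log (1 + (a - y) ^ 2 / b)) a| ≤ 3 := by
  intro a
  have hb0 : 0 < b := by linarith
  have hp : ∀ t : ℝ, 0 < b + (t - y) ^ 2 := fun t => by positivity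
  have hx : ∀ t : ℝ, HasDerivAt (fun t : ℝ => t - y) 1 t := fun t => (hasDerivAt_id t).sub_const y
  have hq : ∀ t : ℝ, HasDerivAt (fun t : ℝ => b + (t - y) ^ 2) (2 * (t - y)) t := fun t => by
    simpa using ((hx t).fun_pow 2).const_add b
  have d1 : deriv (fun a : ℝ => Real.log (1 + (a - y) ^ 2 / b))
      = fun t => 2 * (t - y) / (b + (t - y) ^ 2) := by
    funext t
    have h : HasDerivAt (fun t : ℝ => 1 + (t - y) ^ 2 / b) (2 * (t - y) / b) t := by
      simpa using (((hx t).fun_pow 2).div_const b).const_add 1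
    have hpos : 0 < 1 + (t - y) ^ 2 / b := by positivity
    rw [(h.log hpos.ne').deriv]
    have := (hp t).ne'
    field_simp
  have d2 : deriv (fun t : ℝ => 2 * (t - y) / (b + (t - y) ^ 2))
      = fun t => 2 * (b - (t - y) ^ 2) / (b + (t - y) ^ 2) ^ 2 := by
    funext t
    rw [(((hx t).const_mul 2).fun_div (hq t) (hp t).ne').deriv]
    congr 1
    ring
  have d3 : deriv (fun t : ℝ => 2 * (b - (t - y) ^ 2) / (b + (t - y) ^ 2) ^ 2) a
      = (4 * (a - y) ^ 3 - 12 * b * (a - y)) / (b + (a - y) ^ 2) ^ 3 := by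
    have h := ((((hx a).fun_pow 2).const_sub b).const_mul 2).fun_div ((hq a).fun_pow 2)
      (pow_ne_zero 2 (hp a).ne')
    rw [h.deriv]
    have := (hp a).ne'
    field_simp
    push_cast
    ring
  rw [iteratedDeriv_succ, iteratedDeriv_succ, iteratedDeriv_one, d1, d2, d3]
  have hpos : 0 < (b + (a - y) ^ 2) ^ 3 := pow_pos (hp a) 3
  rw [abs_le, le_div_iff₀ hpos, div_le_iff₀ hpos]
  have h1 := cauchy_aux_poly2 b (a - y) hb
  have h2 := cauchy_aux_poly2 b (-(a - y)) hb
  rw [neg_sq, Odd.neg_pow (by decide)] at h2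
  constructor <;> linarith
end
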